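/- For every integer n ≥ 3, the Whitehouse complex Δ_n is pure of dimension n−4: every facet (maximal face under inclusion) of Δ_n has exactly n−3 elements. -/

import Mathlib

/-- `F` is a face of the Whitehouse complex `Δ_n`. -/
def IsWhFace (n : ℕ) (F : Finset (Finset ℕ)) : Prop :=
  (∀ S ∈ F, S ⊆ Finset.Icc 2 n ∧ 2 ≤ S.card ∧ S.card ≤ n - 2) ∧
  ∀ S ∈ F, ∀ T ∈ F, S ⊆ T ∨ T ⊆ S ∨ S ∩ T = ∅

section Laminar

variable {α : Type*} [DecidableEq α]

/-- Two sets are laminar if they are nested or disjoint. -/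
def LaminarPair (S T : Finset α) : Prop := S ⊆ T ∨ T ⊆ S ∨ S ∩ T = ∅

/-- `G` is a maximal laminar family of nonempty subsets of `X`. -/
structure IsMaxLaminar (X : Finset α) (G : Finset (Finset α)) : Prop where
  subset : ∀ S ∈ G, S ⊆ X
  nonempty : ∀ S ∈ G, S.Nonempty
  pair : ∀ S ∈ G, ∀ T ∈ G, LaminarPair S T
  mem : ∀ S ⊆ X, S.Nonempty → (∀ T ∈ G, LaminarPair S T) → S ∈ G

lemma LaminarPair.symm {S T : Finset α} (h : LaminarPair S T) : LaminarPair T S := by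
  unfold LaminarPair at *
  rw [Finset.inter_comm]
  tauto

lemma laminarPair_of_subset_of_disjoint {A B S T : Finset α} (h : A ∩ B = ∅) (hS : S ⊆ A)
    (hT : T ⊆ B) : LaminarPair S T :=
  Or.inr <| Or.inr <| Finset.subset_empty.1 <| h ▸ Finset.inter_subset_inter hS hT

lemma laminarPair_singleton (x : α) (T : Finset α) : LaminarPair {x} T := by
  by_cases h : x ∈ T
  · exact Or.inl (by simpa using h)
  · exact Or.inr (Or.inr (Finset.singleton_inter_of_notMem h))

namespace IsMaxLaminar

variable {X : Finset α} {G : Finset (Finset α)}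

lemma self_mem (h : IsMaxLaminar X G) (hX : X.Nonempty) : X ∈ G :=
  h.mem X subset_rfl hX fun T hT => Or.inr (Or.inl (h.subset T hT))

lemma singleton_mem (h : IsMaxLaminar X G) {x : α} (hx : x ∈ X) : {x} ∈ G :=
  h.mem _ (by simpa using hx) (by simp) fun T _ => laminarPair_singleton x T

/-- The members of a maximal laminar family inside a member `A` are maximal laminar on `A`. -/
lemma restrict (h : IsMaxLaminar X G) {A : Finset α} (hA : A ∈ G) :
    IsMaxLaminar A (G.filter (· ⊆ A)) where
  subset S hS := (Finset.mem_filter.1 hS).2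
  nonempty S hS := h.nonempty S (Finset.mem_filter.1 hS).1
  pair S hS T hT := h.pair S (Finset.mem_filter.1 hS).1 T (Finset.mem_filter.1 hT).1
  mem S hS hne hc := by
    refine Finset.mem_filter.2 ⟨h.mem S (hS.trans (h.subset A hA)) hne fun T hT => ?_, hS⟩
    rcases h.pair A hA T hT with hAT | hTA | hd
    · exact Or.inl (hS.trans hAT)
    · exact hc T (Finset.mem_filter.2 ⟨hT, hTA⟩)
    · exact laminarPair_of_subset_of_disjoint hd hS subset_rfl

/-- The ground set splits into two members, and every other member lies inside one of them. -/
lemma exists_split (h : IsMaxLaminar X G) (hX : 1 < X.card) :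
    ∃ A ∈ G, A ⊂ X ∧ X \ A ∈ G ∧ ∀ T ∈ G, T ≠ X → T ⊆ A ∨ T ⊆ X \ A := by
  obtain ⟨x, hx⟩ := Finset.card_pos.1 (zero_lt_one.trans hX)
  have hne : (G.erase X).Nonempty := by
    refine ⟨{x}, Finset.mem_erase.2 ⟨?_, h.singleton_mem hx⟩⟩
    rintro rfl
    simp at hX
  obtain ⟨A, hA, hAmax⟩ := Finset.exists_max_image (G.erase X) Finset.card hne
  obtain ⟨hAX, hAG⟩ := Finset.mem_erase.1 hA
  have hsub := h.subset A hAG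
  have hss : A ⊂ X := Finset.ssubset_iff_subset_ne.2 ⟨hsub, hAX⟩
  have hsplit : ∀ T ∈ G, T ≠ X → T ⊆ A ∨ T ⊆ X \ A := by
    intro T hT hTX
    rcases h.pair A hAG T hT with hAT | hTA | hd
    · have := Finset.eq_of_subset_of_card_le hAT (hAmax T (Finset.mem_erase.2 ⟨hTX, hT⟩))
      exact Or.inl this.symm.subset
    · exact Or.inl hTA
    · refine Or.inr (Finset.subset_sdiff.2 ⟨h.subset T hT, ?_⟩)
      exact (Finset.disjoint_iff_inter_eq_empty.2 hd).symm
  refine ⟨A, hAG, hss, ?_, hsplit⟩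
  refine h.mem _ Finset.sdiff_subset (Finset.sdiff_nonempty.2 hss.not_subset) fun T hT => ?_
  by_cases hTX : T = X
  · exact Or.inl (hTX ▸ Finset.sdiff_subset)
  · rcases hsplit T hT hTX with hTA | hTB
    · exact laminarPair_of_subset_of_disjoint (Finset.sdiff_inter_self A X) subset_rfl hTA
    · exact Or.inr (Or.inl hTB)

theorem card_add_one (h : IsMaxLaminar X G) (hX : X.Nonempty) : G.card + 1 = 2 * X.card := by
  induction hm : X.card using Nat.strong_induction_on generalizing X G with
  | _ m ih =>
    subst hm
    by_cases h1 : X.card = 1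
    · obtain ⟨x, rfl⟩ := Finset.card_eq_one.1 h1
      have : G = {{x}} := by
        refine Finset.eq_singleton_iff_unique_mem.2 ⟨h.self_mem hX, fun S hS => ?_⟩
        exact (h.nonempty S hS).subset_singleton_iff.1 (h.subset S hS)
      simp [this]
    · have hpos := hX.card_pos
      obtain ⟨A, hA, hss, hB, hsplit⟩ := h.exists_split (by omega)
      have hAne := h.nonempty A hA
      have hcard := Finset.card_sdiff_add_card_eq_card hss.subset
      have hApos := hAne.card_pos
      have hBpos := (h.nonempty _ hB).card_pos
      have iA := ih A.card (by omega) (h.restrict hA) hAne rfl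
      have iB := ih (X \ A).card (by omega) (h.restrict hB) (h.nonempty _ hB) rfl
      have hdisj : Disjoint (G.filter (· ⊆ A)) (G.filter (· ⊆ X \ A)) := by
        refine Finset.disjoint_left.2 fun S hSA hSB => ?_
        rw [Finset.mem_filter] at hSA hSB
        obtain ⟨y, hy⟩ := h.nonempty S hSA.1
        exact (Finset.mem_sdiff.1 (hSB.2 hy)).2 (hSA.2 hy)
      have hunion : G.erase X = G.filter (· ⊆ A) ∪ G.filter (· ⊆ X \ A) := by
        ext S
        simp only [Finset.mem_erase, Finset.mem_union, Finset.mem_filter]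
        constructor
        · rintro ⟨hSX, hS⟩
          exact (hsplit S hS hSX).imp (⟨hS, ·⟩) (⟨hS, ·⟩)
        · rintro (⟨hS, hSA⟩ | ⟨hS, hSB⟩)
          · refine ⟨?_, hS⟩
            rintro rfl
            exact hss.not_subset hSA
          · refine ⟨?_, hS⟩
            rintro rfl
            have := Finset.card_le_card hSB
            omega
      have herase := Finset.card_erase_add_one (h.self_mem hX)
      rw [hunion, Finset.card_union_of_disjoint hdisj] at herase
      omega

end IsMaxLaminar

end Laminar

lemma IsWhFace.insert_vertex {n : ℕ} {F : Finset (Finset ℕ)} (hF : IsWhFace n F) {S : Finset ℕ}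
    (hS : S ⊆ Finset.Icc 2 n) (h2 : 2 ≤ S.card) (hn : S.card ≤ n - 2)
    (hc : ∀ T ∈ F, LaminarPair S T) : IsWhFace n (insert S F) := by
  refine ⟨fun T hT => ?_, fun T hT U hU => ?_⟩
  · rcases Finset.mem_insert.1 hT with rfl | hT
    · exact ⟨hS, h2, hn⟩
    · exact hF.1 T hT
  · rcases Finset.mem_insert.1 hT with rfl | hTF <;> rcases Finset.mem_insert.1 hU with rfl | hUF
    · exact Or.inl subset_rfl
    · exact hc U hUF
    · exact (hc T hTF).symm
    · exact hF.2 T hTF U hUF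

/-- A facet of `Δ_n`, together with the ground set and its singletons, is a maximal laminar
family. -/
lemma isMaxLaminar_of_facet {n : ℕ} (hn : 3 ≤ n) {F : Finset (Finset ℕ)} (hF : IsWhFace n F)
    (hmax : ∀ G : Finset (Finset ℕ), IsWhFace n G → F ⊆ G → F = G) :
    IsMaxLaminar (Finset.Icc 2 n)
      (insert (Finset.Icc 2 n) ((Finset.Icc 2 n).image singleton ∪ F)) := by
  have hX : (Finset.Icc 2 n).card = n - 1 := by simp
  have hsub : ∀ S ∈ insert (Finset.Icc 2 n) ((Finset.Icc 2 n).image singleton ∪ F),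
      S ⊆ Finset.Icc 2 n := by
    intro S hS
    simp only [Finset.mem_insert, Finset.mem_union, Finset.mem_image] at hS
    rcases hS with rfl | ⟨x, hx, rfl⟩ | hS
    · exact subset_rfl
    · exact Finset.singleton_subset_iff.2 hx
    · exact (hF.1 S hS).1
  refine ⟨hsub, fun S hS => ?_, fun S hS T hT => ?_, fun S hS hne hc => ?_⟩
  · simp only [Finset.mem_insert, Finset.mem_union, Finset.mem_image] at hS
    rcases hS with rfl | ⟨x, hx, rfl⟩ | hS
    · exact Finset.card_pos.1 (by omega)
    · exact Finset.singleton_nonempty x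
    · exact Finset.card_pos.1 (by have := (hF.1 S hS).2.1; omega)
  · have hSX := hsub S hS
    have hTX := hsub T hT
    simp only [Finset.mem_insert, Finset.mem_union, Finset.mem_image] at hS hT
    rcases hS with rfl | ⟨x, -, rfl⟩ | hS
    · exact Or.inr (Or.inl hTX)
    · exact laminarPair_singleton x T
    · rcases hT with rfl | ⟨y, -, rfl⟩ | hT
      · exact Or.inl hSX
      · exact (laminarPair_singleton y S).symm
      · exact hF.2 S hS T hT
  · simp only [Finset.mem_insert, Finset.mem_union, Finset.mem_image]
    have hpos := hne.card_pos
    by_cases h1 : S.card = 1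
    · obtain ⟨x, rfl⟩ := Finset.card_eq_one.1 h1
      exact Or.inr (Or.inl ⟨x, Finset.singleton_subset_iff.1 hS, rfl⟩)
    by_cases h2 : S.card ≤ n - 2
    · have hface := hF.insert_vertex hS (by omega) h2 fun T hT =>
        hc T (Finset.mem_insert_of_mem (Finset.mem_union_right _ hT))
      have := hmax _ hface (Finset.subset_insert S F)
      exact Or.inr (Or.inr (this ▸ Finset.mem_insert_self S F))
    · exact Or.inl (Finset.eq_of_subset_of_card_le hS (by omega))

/-- The Whitehouse complex `Δ_n` is pure of dimension `n - 4`: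
every facet (face maximal under inclusion) has exactly `n - 3` elements. -/
theorem stmt4 (n : ℕ) (hn : 3 ≤ n) (F : Finset (Finset ℕ))
    (hF : IsWhFace n F)
    (hmax : ∀ G : Finset (Finset ℕ), IsWhFace n G → F ⊆ G → F = G) :
    F.card = n - 3 := by
  have hX : (Finset.Icc 2 n).card = n - 1 := by simp
  have hcard := (isMaxLaminar_of_facet hn hF hmax).card_add_one (Finset.card_pos.1 (by omega))
  have hdisj : Disjoint ((Finset.Icc 2 n).image singleton) F := by
    refine Finset.disjoint_left.2 fun S hS hSF => ?_
    obtain ⟨x, -, rfl⟩ := Finset.mem_image.1 hS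
    have := (hF.1 _ hSF).2.1
    simp at this
  have hnot : Finset.Icc 2 n ∉ (Finset.Icc 2 n).image singleton ∪ F := by
    intro h
    rcases Finset.mem_union.1 h with h | h
    · obtain ⟨x, -, hx⟩ := Finset.mem_image.1 h
      rw [← hx, Finset.card_singleton] at hX
      omega
    · have := (hF.1 _ h).2.2
      omega
  rw [Finset.card_insert_of_notMem hnot, Finset.card_union_of_disjoint hdisj,
    Finset.card_image_of_injective _ Finset.singleton_injective] at hcard
  omega
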